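/- Let k ≥ 1 and let λ_1,…,λ_k and α_1,…,α_{k−1} be real numbers. Let T be the k×k real matrix with T_{ii} = λ_i for 1 ≤ i ≤ k, T_{i,i+1} = α_i and T_{i+1,i} = 1 for 1 ≤ i ≤ k−1, and all other entries 0. Then for every n ≥ 0, the (1,1) entry of T^n equals ∑_{π} ∏_{V ∈ π, |V|=1} λ_{d(V,π)} · ∏_{V ∈ π, |V|=2} α_{d(V,π)}, where the sum is over all non-crossing partitions π of {1,…,n} into blocks of size 1 or 2 such that every block of size 2 has depth d(V,π) at most k−1. -/

import Mathlib

/-- The tridiagonal matrix with diagonal `λ_1, …, λ_k`, superdiagonal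
`α_1, …, α_{k−1}` and subdiagonal ones. -/
def Tmat (k : ℕ) (l a : ℕ → ℝ) : Matrix (Fin k) (Fin k) ℝ :=
  Matrix.of fun i j =>
    if (i : ℕ) = (j : ℕ) then l ((i : ℕ) + 1)
    else if (i : ℕ) + 1 = (j : ℕ) then a ((i : ℕ) + 1)
    else if (j : ℕ) + 1 = (i : ℕ) then 1 else 0

/-- `π` is a partition of `{1, …, m}` into blocks of size 1 or 2. -/
def IsPartition12 (m : ℕ) (π : Finset (Finset ℕ)) : Prop :=
  (∀ P ∈ π, P.card = 1 ∨ P.card = 2) ∧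
  (∀ i : ℕ, (∃ P ∈ π, i ∈ P) ↔ i ∈ Finset.Icc 1 m) ∧
  (∀ P ∈ π, ∀ Q ∈ π, P ≠ Q → Disjoint P Q)

/-- Non-crossing: there are no two blocks `U`, `V` and elements `a < b < c < d`
with `a, c ∈ U` and `b, d ∈ V`. -/
def NonCrossing (π : Finset (Finset ℕ)) : Prop :=
  ∀ U ∈ π, ∀ V ∈ π, U ≠ V →
    ¬ ∃ a ∈ U, ∃ b ∈ V, ∃ c ∈ U, ∃ d ∈ V, a < b ∧ b < c ∧ c < d

/-- `U ⪰ V`: there exist `a, b ∈ U` with `a ≤ c ≤ b` for every `c ∈ V`. -/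
def Covers (U V : Finset ℕ) : Prop :=
  ∃ a ∈ U, ∃ b ∈ U, ∀ c ∈ V, a ≤ c ∧ c ≤ b

/-- The depth `d(V, π)` of a block `V`: the number of blocks `U ∈ π` with `U ⪰ V`. -/
noncomputable def blockDepth (π : Finset (Finset ℕ)) (V : Finset ℕ) : ℕ :=
  Set.ncard {U : Finset ℕ | U ∈ π ∧ Covers U V}

open Classical in
/-- Non-crossing partitions of `{1, …, n}` into blocks of size 1 or 2 in which
every block of size 2 has depth at most `k − 1`. -/
noncomputable def NC12 (k n : ℕ) : Finset (Finset (Finset ℕ)) :=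
  ((Finset.Icc 1 n).powerset.powerset).filter
    (fun π => IsPartition12 n π ∧ NonCrossing π ∧
      ∀ V ∈ π, V.card = 2 → blockDepth π V ≤ k - 1)

/-- The weight `∏_{|V|=1} λ_{d(V,π)} · ∏_{|V|=2} α_{d(V,π)}` of a partition. -/
noncomputable def jacobiWeight (l a : ℕ → ℝ) (π : Finset (Finset ℕ)) : ℝ :=
  (∏ V ∈ π.filter (fun V => V.card = 1), l (blockDepth π V)) *
  (∏ V ∈ π.filter (fun V => V.card = 2), a (blockDepth π V))

/-- Containment of the intervals `[v.1, v.2] ⊆ [u.1, u.2]`. -/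
def Encloses (u v : ℕ × ℕ) : Prop := u.1 ≤ v.1 ∧ v.2 ≤ u.2

instance (u v : ℕ × ℕ) : Decidable (Encloses u v) := by unfold Encloses; infer_instance

/-- The number of intervals of `q` containing `v`. -/
def arcDepth (q : Finset (ℕ × ℕ)) (v : ℕ × ℕ) : ℕ := (q.filter (fun u => Encloses u v)).card

/-- The weight of a family of intervals, a degenerate interval standing for a singleton block. -/
def arcWeight (l a : ℕ → ℝ) (q : Finset (ℕ × ℕ)) : ℝ :=
  ∏ v ∈ q, if v.1 = v.2 then l (arcDepth q v) else a (arcDepth q v)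

/-- Partial non-crossing partitions of `{m+1, …, n}` encoded by the pairs `(min V, max V)`.
A pair `(0, j)` is a half-open block: its maximum is `j` and its minimum, still to be chosen, is
at most `m`. There are `h` half-open blocks. -/
structure IsArcSystem (k m n h : ℕ) (q : Finset (ℕ × ℕ)) : Prop where
  bounds : ∀ v ∈ q, (v.1 = 0 ∨ m < v.1) ∧ v.1 ≤ v.2 ∧ m < v.2 ∧ v.2 ≤ n
  cover : ∀ i, m < i → i ≤ n → ∃ v ∈ q, v.1 = i ∨ v.2 = i
  disj : ∀ u ∈ q, ∀ v ∈ q, u ≠ v → u.2 ≠ v.2 ∧ u.1 ≠ v.2 ∧ (u.1 = v.1 → u.1 = 0)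
  noncrossing : ∀ u ∈ q, ∀ v ∈ q, ¬ (u.1 < v.1 ∧ v.1 < u.2 ∧ u.2 < v.2)
  depth_le : ∀ v ∈ q, v.1 < v.2 → arcDepth q v ≤ k - 1
  card_open : (q.filter (fun v => v.1 = 0)).card = h

open Classical in
/-- The finite set of all arc systems with the given parameters. -/
noncomputable def arcSystems (k m n h : ℕ) : Finset (Finset (ℕ × ℕ)) :=
  (Finset.range (n + 1) ×ˢ Finset.range (n + 1)).powerset.filter (IsArcSystem k m n h)

theorem mem_arcSystems {k m n h : ℕ} {q : Finset (ℕ × ℕ)} :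
    q ∈ arcSystems k m n h ↔ IsArcSystem k m n h q := by
  simp only [arcSystems, Finset.mem_filter, Finset.mem_powerset, and_iff_right_iff_imp]
  intro hq v hv
  have := hq.bounds v hv
  simp only [Finset.mem_product, Finset.mem_range]
  omega

theorem arcDepth_insert {q : Finset (ℕ × ℕ)} {v : ℕ × ℕ} (hv : v ∉ q) (u : ℕ × ℕ) :
    arcDepth (insert v q) u = arcDepth q u + if Encloses v u then 1 else 0 := by
  unfold arcDepth
  rw [Finset.filter_insert]
  split_ifs
  · rw [Finset.card_insert_of_notMem (by simp [hv])]
  · rfl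

theorem arcDepth_insert_self {q : Finset (ℕ × ℕ)} {v : ℕ × ℕ} (hv : v ∉ q) :
    arcDepth (insert v q) v = arcDepth q v + 1 := by
  rw [arcDepth_insert hv, if_pos ⟨le_rfl, le_rfl⟩]

theorem arcDepth_insert_of_not_encloses {q : Finset (ℕ × ℕ)} {v u : ℕ × ℕ} (hv : v ∉ q)
    (hu : ¬ Encloses v u) : arcDepth (insert v q) u = arcDepth q u := by
  rw [arcDepth_insert hv, if_neg hu, add_zero]

theorem arcWeight_insert (l a : ℕ → ℝ) {q : Finset (ℕ × ℕ)} {v : ℕ × ℕ} (hv : v ∉ q)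
    (hu : ∀ u ∈ q, ¬ Encloses v u) :
    arcWeight l a (insert v q) =
      (if v.1 = v.2 then l (arcDepth q v + 1) else a (arcDepth q v + 1)) * arcWeight l a q := by
  unfold arcWeight
  rw [Finset.prod_insert hv, arcDepth_insert_self hv]
  congr 1
  refine Finset.prod_congr rfl fun u h => ?_
  rw [arcDepth_insert_of_not_encloses hv (hu u h)]

theorem arcDepth_congr {q : Finset (ℕ × ℕ)} {v w : ℕ × ℕ}
    (h : ∀ u ∈ q, (Encloses u v ↔ Encloses u w)) : arcDepth q v = arcDepth q w := by
  unfold arcDepth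
  rw [Finset.filter_congr h]

theorem arcDepth_insert_congr {q : Finset (ℕ × ℕ)} {v w u : ℕ × ℕ} (hv : v ∉ q) (hw : w ∉ q)
    (h : Encloses v u ↔ Encloses w u) : arcDepth (insert v q) u = arcDepth (insert w q) u := by
  simp [arcDepth_insert hv, arcDepth_insert hw, h]

theorem arcWeight_insert_congr (l a : ℕ → ℝ) {q : Finset (ℕ × ℕ)} {v w : ℕ × ℕ}
    (hv : v ∉ q) (hw : w ∉ q) (hvw : v.1 = v.2 ↔ w.1 = w.2)
    (h : ∀ u ∈ q, (Encloses u v ↔ Encloses u w))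
    (h' : ∀ u ∈ q, (Encloses v u ↔ Encloses w u)) :
    arcWeight l a (insert v q) = arcWeight l a (insert w q) := by
  unfold arcWeight
  rw [Finset.prod_insert hv, Finset.prod_insert hw, arcDepth_insert_self hv,
    arcDepth_insert_self hw, arcDepth_congr h]
  simp only [hvw]
  congr 1
  refine Finset.prod_congr rfl fun u hu => ?_
  rw [arcDepth_insert_congr hv hw (h' u hu)]

/-- The depth of a block whose maximum lies to the left of all of `q`. -/
theorem arcDepth_eq_card_open {q : Finset (ℕ × ℕ)} {m : ℕ} {v : ℕ × ℕ}
    (hq : ∀ u ∈ q, (u.1 = 0 ∨ m < u.1) ∧ m < u.2) (hv : v.1 ≤ v.2) (hm : v.2 ≤ m) :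
    arcDepth q v = (q.filter (fun u => u.1 = 0)).card := by
  unfold arcDepth
  congr 1
  refine Finset.filter_congr fun u hu => ?_
  have := hq u hu
  unfold Encloses
  omega

theorem isArcSystem_insert_singleton {k m n h : ℕ} {q : Finset (ℕ × ℕ)} (hmn : m < n)
    (hq : (m + 1, m + 1) ∉ q) :
    IsArcSystem k m n h (insert (m + 1, m + 1) q) ↔ IsArcSystem k (m + 1) n h q := by
  constructor
  · intro H
    have hb : ∀ v ∈ q, (v.1 = 0 ∨ m + 1 < v.1) ∧ v.1 ≤ v.2 ∧ m + 1 < v.2 ∧ v.2 ≤ n := by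
      intro v hv
      have h1 := H.bounds v (by simp [hv])
      have h2 := H.disj (m + 1, m + 1) (by simp) v (by simp [hv]) (by grind)
      grind
    refine ⟨hb, ?_, ?_, ?_, ?_, ?_⟩
    · intro i h1 h2
      obtain ⟨v, hv, h3⟩ := H.cover i (by omega) h2
      grind
    · exact fun u hu v hv => H.disj u (by simp [hu]) v (by simp [hv])
    · exact fun u hu v hv => H.noncrossing u (by simp [hu]) v (by simp [hv])
    · intro v hv hlt
      have := H.depth_le v (by simp [hv]) hlt
      rwa [arcDepth_insert_of_not_encloses hq] at this
      have := hb v hv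
      unfold Encloses; omega
    · rw [← H.card_open, Finset.filter_insert, if_neg (by simp)]
  · intro H
    have hb := H.bounds
    refine ⟨?_, ?_, ?_, ?_, ?_, ?_⟩
    · intro v hv; grind
    · intro i h1 h2
      rcases eq_or_ne i (m + 1) with rfl | h3
      · exact ⟨(m + 1, m + 1), by simp, by simp⟩
      · obtain ⟨v, hv, h4⟩ := H.cover i (by omega) h2
        exact ⟨v, by simp [hv], h4⟩
    · intro u hu v hv huv
      have := H.disj u
      grind
    · intro u hu v hv
      have := H.noncrossing u
      grind
    · intro v hv hlt
      rcases Finset.mem_insert.1 hv with rfl | hv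
      · simp at hlt
      · rw [arcDepth_insert_of_not_encloses hq]
        · exact H.depth_le v hv hlt
        · have := hb v hv
          unfold Encloses; omega
    · rw [← H.card_open, Finset.filter_insert, if_neg (by simp)]

theorem isArcSystem_insert_open {k m n h : ℕ} {q : Finset (ℕ × ℕ)} (hmn : m < n)
    (hq : (0, m + 1) ∉ q) :
    IsArcSystem k m n (h + 1) (insert (0, m + 1) q) ↔
      IsArcSystem k (m + 1) n h q ∧ h + 1 ≤ k - 1 := by
  have hcard : ((insert (0, m + 1) q).filter (fun v => v.1 = 0)).card =
      (q.filter (fun v => v.1 = 0)).card + 1 := by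
    rw [Finset.filter_insert, if_pos rfl, Finset.card_insert_of_notMem (by simp [hq])]
  constructor
  · intro H
    have hb : ∀ v ∈ q, (v.1 = 0 ∨ m + 1 < v.1) ∧ v.1 ≤ v.2 ∧ m + 1 < v.2 ∧ v.2 ≤ n := by
      intro v hv
      have h1 := H.bounds v (by simp [hv])
      have h2 := H.disj (0, m + 1) (by simp) v (by simp [hv]) (by grind)
      have h3 := H.disj v (by simp [hv]) (0, m + 1) (by simp) (by grind)
      grind
    have hc : (q.filter (fun v => v.1 = 0)).card = h := by
      have := H.card_open; omega
    refine ⟨⟨hb, ?_, ?_, ?_, ?_, hc⟩, ?_⟩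
    · intro i h1 h2
      obtain ⟨v, hv, h3⟩ := H.cover i (by omega) h2
      grind
    · exact fun u hu v hv => H.disj u (by simp [hu]) v (by simp [hv])
    · exact fun u hu v hv => H.noncrossing u (by simp [hu]) v (by simp [hv])
    · intro v hv hlt
      have := H.depth_le v (by simp [hv]) hlt
      rwa [arcDepth_insert_of_not_encloses hq] at this
      have := hb v hv
      unfold Encloses; omega
    · have := H.depth_le (0, m + 1) (by simp) (by simp)
      rwa [arcDepth_insert_self hq, arcDepth_eq_card_open (m := m + 1) _ (by simp) (by simp),
        hc] at this
      intro u hu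
      have := hb u hu
      omega
  · rintro ⟨H, hk⟩
    have hb := H.bounds
    refine ⟨?_, ?_, ?_, ?_, ?_, ?_⟩
    · intro v hv; grind
    · intro i h1 h2
      rcases eq_or_ne i (m + 1) with rfl | h3
      · exact ⟨(0, m + 1), by simp, by simp⟩
      · obtain ⟨v, hv, h4⟩ := H.cover i (by omega) h2
        exact ⟨v, by simp [hv], h4⟩
    · intro u hu v hv huv
      have := H.disj u
      grind
    · intro u hu v hv
      have := H.noncrossing u
      grind
    · intro v hv hlt
      rcases Finset.mem_insert.1 hv with rfl | hv
      · rwa [arcDepth_insert_self hq, arcDepth_eq_card_open (m := m + 1) _ (by simp) (by simp),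
          H.card_open]
        intro u hu
        have := hb u hu
        omega
      · rw [arcDepth_insert_of_not_encloses hq]
        · exact H.depth_le v hv hlt
        · have := hb v hv
          unfold Encloses; omega
    · rw [hcard, H.card_open]

/-- Closing the half-open block `(0, j)` at `m + 1`. -/
theorem isArcSystem_insert_pair {k m n h j : ℕ} {q : Finset (ℕ × ℕ)}
    (hj : m + 1 < j) (hq : (m + 1, j) ∉ q) (hq' : (0, j) ∉ q) :
    IsArcSystem k m n h (insert (m + 1, j) q) ↔
      IsArcSystem k (m + 1) n (h + 1) (insert (0, j) q) ∧ ∀ v ∈ q, v.1 = 0 → j ≤ v.2 := by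
  have hcard : ((insert (0, j) q).filter (fun v => v.1 = 0)).card =
      ((insert (m + 1, j) q).filter (fun v => v.1 = 0)).card + 1 := by
    rw [Finset.filter_insert, if_pos rfl, Finset.card_insert_of_notMem (by simp [hq']),
      Finset.filter_insert, if_neg (by simp)]
  have hdepth : (∀ v ∈ q, (v.1 = 0 ∨ m + 1 < v.1) ∧ v.1 ≤ v.2 ∧ m + 1 < v.2 ∧ v.2 ≤ n) →
      (∀ v ∈ q, v.1 = 0 → j < v.2) →
      ((∀ v ∈ insert (m + 1, j) q, v.1 < v.2 → arcDepth (insert (m + 1, j) q) v ≤ k - 1) ↔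
      (∀ v ∈ insert (0, j) q, v.1 < v.2 → arcDepth (insert (0, j) q) v ≤ k - 1)) := by
    intro hb hopen
    simp only [Finset.forall_mem_insert]
    rw [arcDepth_insert_self hq, arcDepth_insert_self hq',
      arcDepth_congr (v := (m + 1, j)) (w := (0, j))]
    · refine and_congr (by grind) (forall₂_congr fun v hv => ?_)
      rw [arcDepth_insert_congr hq hq']
      have := hb v hv
      have := hopen v hv
      simp only [Encloses]; omega
    · intro u hu
      have := hb u hu
      have := hopen u hu
      simp only [Encloses]; omega
  constructor
  · intro H
    have hd : ∀ v ∈ q, v.2 ≠ j ∧ v.1 ≠ j ∧ v.1 ≠ m + 1 ∧ v.2 ≠ m + 1 := by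
      intro v hv
      have h2 := H.disj (m + 1, j) (by simp) v (by simp [hv]) (by grind)
      have h3 := H.disj v (by simp [hv]) (m + 1, j) (by simp) (by grind)
      grind
    have hb : ∀ v ∈ q, (v.1 = 0 ∨ m + 1 < v.1) ∧ v.1 ≤ v.2 ∧ m + 1 < v.2 ∧ v.2 ≤ n := by
      intro v hv
      have h1 := H.bounds v (by simp [hv])
      have h2 := hd v hv
      omega
    have hjn : j ≤ n := (H.bounds (m + 1, j) (by simp)).2.2.2
    have hopen : ∀ v ∈ q, v.1 = 0 → j < v.2 := by
      intro v hv h0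
      have h1 := H.noncrossing v (by simp [hv]) (m + 1, j) (by simp)
      have h2 := hd v hv
      have h3 := hb v hv
      simp only [h0] at h1
      omega
    refine ⟨⟨?_, ?_, ?_, ?_, ?_, ?_⟩, fun v hv h0 => (hopen v hv h0).le⟩
    · intro v hv; grind
    · intro i h1 h2
      obtain ⟨v, hv, h3⟩ := H.cover i (by omega) h2
      rcases Finset.mem_insert.1 hv with rfl | hv
      · exact ⟨(0, j), by simp, by grind⟩
      · exact ⟨v, by simp [hv], h3⟩
    · intro u hu v hv huv
      have h1 := H.disj u
      have h2 := hd u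
      have h3 := hd v
      have h4 := hb u
      have h5 := hb v
      grind
    · intro u hu v hv
      have h1 := H.noncrossing u
      have h2 := H.noncrossing (m + 1, j) (by simp)
      have h3 := hopen v
      have h4 := hb v
      have h5 := hb u
      grind
    · exact (hdepth hb hopen).1 H.depth_le
    · rw [hcard, H.card_open]
  · rintro ⟨H, hle⟩
    have hd : ∀ v ∈ q, v.2 ≠ j ∧ v.1 ≠ j := by
      intro v hv
      have h2 := H.disj (0, j) (by simp) v (by simp [hv]) (by grind)
      have h3 := H.disj v (by simp [hv]) (0, j) (by simp) (by grind)
      grind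
    have hb : ∀ v ∈ q, (v.1 = 0 ∨ m + 1 < v.1) ∧ v.1 ≤ v.2 ∧ m + 1 < v.2 ∧ v.2 ≤ n :=
      fun v hv => H.bounds v (by simp [hv])
    have hjn : j ≤ n := (H.bounds (0, j) (by simp)).2.2.2
    have hopen : ∀ v ∈ q, v.1 = 0 → j < v.2 :=
      fun v hv h0 => lt_of_le_of_ne (hle v hv h0) (hd v hv).1.symm
    refine ⟨?_, ?_, ?_, ?_, ?_, ?_⟩
    · intro v hv; grind
    · intro i h1 h2
      rcases eq_or_ne i (m + 1) with rfl | h3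
      · exact ⟨(m + 1, j), by simp, by simp⟩
      · obtain ⟨v, hv, h4⟩ := H.cover i (by omega) h2
        rcases Finset.mem_insert.1 hv with rfl | hv
        · exact ⟨(m + 1, j), by simp, by grind⟩
        · exact ⟨v, by simp [hv], h4⟩
    · intro u hu v hv huv
      have h1 := H.disj u
      have h2 := hd u
      have h3 := hd v
      have h4 := hb u
      have h5 := hb v
      grind
    · intro u hu v hv
      have h1 := H.noncrossing u
      have h2 := H.noncrossing (0, j) (by simp)
      have h3 := hopen u
      have h4 := hb v
      have h5 := hb u
      grind
    · exact (hdepth hb hopen).2 H.depth_le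
    · have := H.card_open; omega

/-- The total weight of the arc systems with the given parameters. -/
noncomputable def arcSum (l a : ℕ → ℝ) (k m n h : ℕ) : ℝ :=
  ∑ q ∈ arcSystems k m n h, arcWeight l a q

theorem IsArcSystem.exists_min_open {k m n h : ℕ} {q : Finset (ℕ × ℕ)}
    (H : IsArcSystem k m n h q) (hh : 1 ≤ h) :
    ∃ j, (0, j) ∈ q ∧ ∀ v ∈ q, v.1 = 0 → j ≤ v.2 := by
  have hne : (q.filter (fun v => v.1 = 0)).Nonempty := by
    rw [← Finset.card_pos, H.card_open]; omega
  obtain ⟨⟨i, j⟩, hv, hmin⟩ := Finset.exists_min_image _ (fun v : ℕ × ℕ => v.2) hne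
  simp only [Finset.mem_filter] at hv hmin
  obtain ⟨hv, rfl⟩ := hv
  exact ⟨j, hv, fun v h1 h2 => hmin v ⟨h1, h2⟩⟩

theorem arcSum_eq_zero (l a : ℕ → ℝ) {k m n h : ℕ} (hk : 1 ≤ k) (hh : k ≤ h) :
    arcSum l a k m n h = 0 := by
  unfold arcSum
  rw [Finset.sum_eq_zero]
  intro q hq
  rw [mem_arcSystems] at hq
  obtain ⟨j, hj, hmin⟩ := hq.exists_min_open (by omega)
  have h1 := hq.depth_le _ hj (by have := hq.bounds _ hj; grind)
  have h2 : (q.filter (fun v => v.1 = 0)).card ≤ arcDepth q (0, j) := by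
    refine Finset.card_le_card fun v hv => ?_
    simp only [Finset.mem_filter] at hv ⊢
    exact ⟨hv.1, by simp [hv.2], hmin v hv.1 hv.2⟩
  rw [hq.card_open] at h2
  omega

theorem sum_arcSystems_singleton (l a : ℕ → ℝ) {k m n h : ℕ} (hmn : m < n) :
    ∑ q ∈ (arcSystems k m n h).filter (fun q => (m + 1, m + 1) ∈ q), arcWeight l a q =
      l (h + 1) * arcSum l a k (m + 1) n h := by
  unfold arcSum
  rw [Finset.mul_sum]
  have hnot : ∀ q ∈ arcSystems k (m + 1) n h, (m + 1, m + 1) ∉ q := fun q hq hc => by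
    have := (mem_arcSystems.1 hq).bounds _ hc
    simp at this
  symm
  refine Finset.sum_bij' (fun q _ => insert (m + 1, m + 1) q)
    (fun q _ => q.erase (m + 1, m + 1)) ?_ ?_ ?_ ?_ ?_
  · intro q hq
    simp only [Finset.mem_filter, mem_arcSystems, Finset.mem_insert_self, and_true]
    exact (isArcSystem_insert_singleton hmn (hnot q hq)).2 (mem_arcSystems.1 hq)
  · intro q hq
    simp only [Finset.mem_filter, mem_arcSystems] at hq ⊢
    rw [← isArcSystem_insert_singleton hmn (by simp), Finset.insert_erase hq.2]
    exact hq.1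
  · intro q hq
    exact Finset.erase_insert (hnot q hq)
  · intro q hq
    exact Finset.insert_erase (Finset.mem_filter.1 hq).2
  · intro q hq
    have H := mem_arcSystems.1 hq
    have hb := H.bounds
    rw [arcWeight_insert l a (hnot q hq), if_pos rfl,
      arcDepth_eq_card_open (m := m + 1) (by grind) le_rfl le_rfl, H.card_open]
    intro u hu
    have := hb u hu
    simp only [Encloses]; omega

theorem sum_arcSystems_open (l a : ℕ → ℝ) {k m n h : ℕ} (hmn : m < n) (hk : h + 1 ≤ k - 1) :
    ∑ q ∈ (arcSystems k m n (h + 1)).filter (fun q => (0, m + 1) ∈ q), arcWeight l a q =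
      a (h + 1) * arcSum l a k (m + 1) n h := by
  unfold arcSum
  rw [Finset.mul_sum]
  have hnot : ∀ q ∈ arcSystems k (m + 1) n h, (0, m + 1) ∉ q := fun q hq hc => by
    have := (mem_arcSystems.1 hq).bounds _ hc
    simp at this
  symm
  refine Finset.sum_bij' (fun q _ => insert (0, m + 1) q)
    (fun q _ => q.erase (0, m + 1)) ?_ ?_ ?_ ?_ ?_
  · intro q hq
    simp only [Finset.mem_filter, mem_arcSystems, Finset.mem_insert_self, and_true]
    exact (isArcSystem_insert_open hmn (hnot q hq)).2 ⟨mem_arcSystems.1 hq, hk⟩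
  · intro q hq
    simp only [Finset.mem_filter, mem_arcSystems] at hq ⊢
    refine ((isArcSystem_insert_open hmn (by simp)).1 ?_).1
    rw [Finset.insert_erase hq.2]
    exact hq.1
  · intro q hq
    exact Finset.erase_insert (hnot q hq)
  · intro q hq
    exact Finset.insert_erase (Finset.mem_filter.1 hq).2
  · intro q hq
    have H := mem_arcSystems.1 hq
    have hb := H.bounds
    rw [arcWeight_insert l a (hnot q hq), if_neg (by simp),
      arcDepth_eq_card_open (m := m + 1) (by grind) (by simp) le_rfl, H.card_open]
    intro u hu
    have := hb u hu
    simp only [Encloses]; omega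

theorem sum_arcSystems_pair (l a : ℕ → ℝ) {k m n h : ℕ} :
    ∑ q ∈ (arcSystems k m n h).filter (fun q => ∃ v ∈ q, v.1 = m + 1 ∧ m + 1 < v.2),
      arcWeight l a q = arcSum l a k (m + 1) n (h + 1) := by
  unfold arcSum
  have hmin : ∀ q, ∃ j, q ∈ arcSystems k (m + 1) n (h + 1) →
      (0, j) ∈ q ∧ ∀ v ∈ q, v.1 = 0 → j ≤ v.2 := by
    intro q
    by_cases hq : q ∈ arcSystems k (m + 1) n (h + 1)
    · obtain ⟨j, hj⟩ := (mem_arcSystems.1 hq).exists_min_open (by omega)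
      exact ⟨j, fun _ => hj⟩
    · exact ⟨0, fun hc => absurd hc hq⟩
  choose J hJ using hmin
  have hfirst : ∀ q ∈ arcSystems k (m + 1) n (h + 1), ∀ v ∈ q, v.1 ≠ m + 1 := by
    intro q hq v hv
    have := (mem_arcSystems.1 hq).bounds v hv
    omega
  have hlt : ∀ q ∈ arcSystems k (m + 1) n (h + 1), m + 1 < J q := fun q hq =>
    ((mem_arcSystems.1 hq).bounds _ (hJ q hq).1).2.2.1
  have hnot : ∀ q ∈ arcSystems k (m + 1) n (h + 1), (m + 1, J q) ∉ q.erase (0, J q) :=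
    fun q hq hc => hfirst q hq _ (Finset.mem_of_mem_erase hc) rfl
  symm
  refine Finset.sum_bij (fun q _ => insert (m + 1, J q) (q.erase (0, J q))) ?_ ?_ ?_ ?_
  · intro q hq
    simp only [Finset.mem_filter, mem_arcSystems]
    refine ⟨?_, (m + 1, J q), by simp, rfl, hlt q hq⟩
    rw [isArcSystem_insert_pair (hlt q hq) (hnot q hq) (by simp),
      Finset.insert_erase (hJ q hq).1]
    exact ⟨mem_arcSystems.1 hq, fun v hv => (hJ q hq).2 v (Finset.mem_of_mem_erase hv)⟩
  · intro q hq q' hq' heq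
    have hJJ : J q = J q' := by
      have h1 : (m + 1, J q) ∈ insert (m + 1, J q') (q'.erase (0, J q')) := by
        rw [← heq]; simp
      rcases Finset.mem_insert.1 h1 with h2 | h2
      · exact (Prod.mk.inj h2).2
      · exact absurd rfl (hfirst q' hq' _ (Finset.mem_of_mem_erase h2))
    have h1 := congrArg (fun s => s.erase (m + 1, J q)) heq
    have h2 := hnot q' hq'
    rw [← hJJ] at h1 h2
    simp only [Finset.erase_insert (hnot q hq), Finset.erase_insert h2] at h1
    have h3 := congrArg (insert (0, J q)) h1
    rwa [Finset.insert_erase (hJ q hq).1, Finset.insert_erase (hJJ ▸ (hJ q' hq').1)] at h3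
  · intro q hq
    simp only [Finset.mem_filter, mem_arcSystems] at hq
    obtain ⟨H, ⟨i, j⟩, hv, rfl, hj⟩ := hq
    simp only at hj
    have h0 : (0, j) ∉ q.erase (m + 1, j) := by
      intro hc
      exact (H.disj _ (Finset.mem_of_mem_erase hc) _ hv (by simp)).1 rfl
    rw [← Finset.insert_erase hv,
      isArcSystem_insert_pair hj (by simp) h0] at H
    have hmem := mem_arcSystems.2 H.1
    have hJj : J (insert (0, j) (q.erase (m + 1, j))) = j := by
      have h1 := hJ _ hmem
      have h2 := h1.2 (0, j) (by simp) rfl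
      rcases Finset.mem_insert.1 h1.1 with h3 | h3
      · exact (Prod.mk.inj h3).2
      · exact le_antisymm h2 (H.2 _ h3 rfl)
    refine ⟨_, hmem, ?_⟩
    rw [hJj, Finset.erase_insert h0, Finset.insert_erase hv]
  · intro q hq
    have hb := (mem_arcSystems.1 hq).bounds
    have hd := (mem_arcSystems.1 hq).disj
    have hj := hJ q hq
    have hjlt := hlt q hq
    have hopen : ∀ u ∈ q.erase (0, J q), u.1 = 0 → J q < u.2 := by
      intro u hu h0
      have h1 := hd u (Finset.mem_of_mem_erase hu) _ hj.1 (Finset.ne_of_mem_erase hu)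
      have h2 := hj.2 u (Finset.mem_of_mem_erase hu) h0
      exact lt_of_le_of_ne h2 h1.1.symm
    nth_rewrite 1 [← Finset.insert_erase hj.1]
    refine arcWeight_insert_congr l a (by simp) (hnot q hq) (by grind) ?_ ?_
    all_goals
      intro u hu
      have h1 := hb u (Finset.mem_of_mem_erase hu)
      have h2 := hopen u hu
      simp only [Encloses]; omega

theorem arcSum_recurrence (l a : ℕ → ℝ) {k m n h : ℕ} (hmn : m < n) (hh : h < k) :
    arcSum l a k m n h = l (h + 1) * arcSum l a k (m + 1) n h +
      (if h = 0 then 0 else a h * arcSum l a k (m + 1) n (h - 1)) +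
      arcSum l a k (m + 1) n (h + 1) := by
  have hopen : ∑ q ∈ (arcSystems k m n h).filter (fun q => (0, m + 1) ∈ q), arcWeight l a q =
      if h = 0 then 0 else a h * arcSum l a k (m + 1) n (h - 1) := by
    rcases h with _ | h
    · rw [if_pos rfl]
      refine Finset.sum_eq_zero fun q hq => ?_
      simp only [Finset.mem_filter, mem_arcSystems] at hq
      exact absurd rfl (Finset.filter_eq_empty_iff.1 (Finset.card_eq_zero.1 hq.1.card_open) hq.2)
    · simpa using sum_arcSystems_open l a hmn (by omega)
  rw [← sum_arcSystems_singleton l a hmn, ← hopen, ← sum_arcSystems_pair l a]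
  have hdisj : ∀ q ∈ arcSystems k m n h, ∀ u ∈ q, ∀ v ∈ q,
      (u.1 = m + 1 ∨ u.2 = m + 1) → (v.1 = m + 1 ∨ v.2 = m + 1) → u = v := by
    intro q hq u hu v hv h1 h2
    by_contra hne
    have h3 := (mem_arcSystems.1 hq).disj u hu v hv hne
    have h4 := (mem_arcSystems.1 hq).disj v hv u hu (Ne.symm hne)
    omega
  unfold arcSum
  rw [← Finset.sum_union, ← Finset.sum_union]
  · refine Finset.sum_congr ?_ fun _ _ => rfl
    ext q
    simp only [Finset.mem_union, Finset.mem_filter, ← and_or_left]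
    refine ⟨fun hq => ⟨hq, ?_⟩, fun hq => hq.1⟩
    obtain ⟨⟨i, j⟩, hv, h1⟩ := (mem_arcSystems.1 hq).cover (m + 1) (by omega) (by omega)
    have h2 := (mem_arcSystems.1 hq).bounds _ hv
    simp only at h1 h2
    rcases Nat.lt_or_ge (m + 1) j with h3 | h3
    · exact Or.inr ⟨_, hv, by simp only; omega, h3⟩
    · obtain rfl : j = m + 1 := by omega
      obtain rfl | rfl : i = 0 ∨ i = m + 1 := by omega
      · exact Or.inl (Or.inr hv)
      · exact Or.inl (Or.inl hv)
  · rw [Finset.disjoint_left]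
    intro q h1 h2
    simp only [Finset.mem_union, Finset.mem_filter] at h1 h2
    obtain ⟨hq, v, hv, hv1, hv2⟩ := h2
    rcases h1 with h1 | h1
    · have := hdisj q hq _ h1.2 v hv (by simp) (by simp [hv1])
      subst this
      simp at hv2
    · have := hdisj q hq _ h1.2 v hv (by simp) (by simp [hv1])
      subst this
      simp at hv2
  · rw [Finset.disjoint_left]
    intro q h1 h2
    simp only [Finset.mem_filter] at h1 h2
    have := hdisj q h1.1 _ h1.2 _ h2.2 (by simp) (by simp)
    simp at this

theorem arcSystems_self (k n h : ℕ) : arcSystems k n n h = if h = 0 then {∅} else ∅ := by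
  have hempty : ∀ q, IsArcSystem k n n h q ↔ q = ∅ ∧ h = 0 := by
    intro q
    constructor
    · intro H
      have hq : q = ∅ := Finset.eq_empty_of_forall_notMem fun v hv => by
        have := H.bounds v hv
        omega
      subst hq
      exact ⟨rfl, by simpa using H.card_open.symm⟩
    · rintro ⟨rfl, rfl⟩
      exact ⟨by simp, by intros; omega, by simp, by simp, by simp, by simp⟩
  ext q
  rw [mem_arcSystems, hempty]
  split_ifs with h0 <;> simp [h0]

theorem Tmat_pow_zero_apply (l a : ℕ → ℝ) {k : ℕ} (hk : 1 ≤ k) (n d m : ℕ) (hd : m + d = n)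
    (i : Fin k) : (Tmat k l a ^ d) ⟨0, hk⟩ i = arcSum l a k m n i := by
  induction d generalizing m i with
  | zero =>
    obtain rfl : m = n := by omega
    rw [pow_zero, Matrix.one_apply, arcSum, arcSystems_self]
    by_cases hi : (i : ℕ) = 0
    · rw [if_pos (Fin.ext hi.symm), if_pos hi]
      simp [arcWeight]
    · rw [if_neg (fun hc => hi (congrArg Fin.val hc).symm), if_neg hi]
      simp
  | succ d ih =>
    rw [pow_succ, Matrix.mul_apply, arcSum_recurrence l a (by omega) i.isLt]
    obtain ⟨h, hi⟩ := i
    have hsum : ∑ j : Fin k, (Tmat k l a ^ d) ⟨0, hk⟩ j * Tmat k l a j ⟨h, hi⟩ =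
        ∑ j ∈ Finset.range k, ((if j = h then l (h + 1) * arcSum l a k (m + 1) n h else 0) +
          (if j + 1 = h then a h * arcSum l a k (m + 1) n (h - 1) else 0) +
          (if j = h + 1 then arcSum l a k (m + 1) n (h + 1) else 0)) := by
      rw [Finset.sum_range]
      refine Finset.sum_congr rfl fun j _ => ?_
      rw [ih (m + 1) (by omega)]
      simp only [Tmat, Matrix.of_apply]
      generalize (j : ℕ) = j
      by_cases h1 : j = h
      · subst h1
        simp [mul_comm]
      · by_cases h2 : j + 1 = h
        · subst h2
          simp [mul_comm]
          omega
        · by_cases h3 : j = h + 1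
          · subst h3; simp [h2]
          · simp [h1, h2, h3, Ne.symm h3]
    rw [hsum, Finset.sum_add_distrib, Finset.sum_add_distrib]
    congr 1
    · congr 1
      · rw [Finset.sum_ite_eq' (Finset.range k) h, if_pos (by simpa using hi)]
      · by_cases h0 : h = 0
        · simp [h0]
        · rw [if_neg h0, Finset.sum_eq_single_of_mem (h - 1) (by simp; omega)]
          · rw [if_pos (by omega)]
          · intro j _ hj
            rw [if_neg (by omega)]
    · rw [Finset.sum_ite_eq' (Finset.range k) (h + 1)]
      split_ifs with h1
      · rfl
      · rw [arcSum_eq_zero l a hk (by simpa using h1)]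

/-- The block with minimum `v.1` and maximum `v.2`. -/
def arcBlock (v : ℕ × ℕ) : Finset ℕ := {v.1, v.2}

theorem mem_arcBlock {v : ℕ × ℕ} {i : ℕ} : i ∈ arcBlock v ↔ i = v.1 ∨ i = v.2 := by
  simp [arcBlock]

theorem covers_arcBlock_iff {u v : ℕ × ℕ} (hu : u.1 ≤ u.2) (hv : v.1 ≤ v.2) :
    Covers (arcBlock u) (arcBlock v) ↔ Encloses u v := by
  simp only [Covers, mem_arcBlock, Encloses]
  constructor
  · rintro ⟨i, hi, j, hj, h⟩
    have h1 := h v.1 (Or.inl rfl)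
    have h2 := h v.2 (Or.inr rfl)
    omega
  · rintro ⟨h1, h2⟩
    refine ⟨u.1, Or.inl rfl, u.2, Or.inr rfl, fun c hc => ?_⟩
    omega

theorem arcBlock_injOn : Set.InjOn arcBlock {v | v.1 ≤ v.2} := by
  intro u hu v hv h
  have h1 : Encloses u v := (covers_arcBlock_iff hu hv).1 (h ▸ (covers_arcBlock_iff hu hu).2
    ⟨le_rfl, le_rfl⟩)
  have h2 : Encloses v u := (covers_arcBlock_iff hv hu).1 (h ▸ (covers_arcBlock_iff hv hv).2
    ⟨le_rfl, le_rfl⟩)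
  unfold Encloses at h1 h2
  ext <;> omega

theorem card_arcBlock (v : ℕ × ℕ) : (arcBlock v).card = if v.1 = v.2 then 1 else 2 := by
  unfold arcBlock
  split_ifs with h
  · simp [h]
  · exact Finset.card_pair h

theorem blockDepth_image_arcBlock {q : Finset (ℕ × ℕ)} (hq : ∀ u ∈ q, u.1 ≤ u.2) {v : ℕ × ℕ}
    (hv : v.1 ≤ v.2) : blockDepth (q.image arcBlock) (arcBlock v) = arcDepth q v := by
  have hset : {U : Finset ℕ | U ∈ q.image arcBlock ∧ Covers U (arcBlock v)} =
      ((q.filter (fun u => Encloses u v)).image arcBlock : Finset (Finset ℕ)) := by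
    ext U
    simp only [Set.mem_ofPred_eq, Finset.mem_image, Finset.coe_image, Set.mem_image,
      Finset.coe_filter]
    constructor
    · rintro ⟨⟨u, hu, rfl⟩, h⟩
      exact ⟨u, ⟨hu, (covers_arcBlock_iff (hq u hu) hv).1 h⟩, rfl⟩
    · rintro ⟨u, ⟨hu, h⟩, rfl⟩
      exact ⟨⟨u, hu, rfl⟩, (covers_arcBlock_iff (hq u hu) hv).2 h⟩
  rw [blockDepth, hset, Set.ncard_coe_finset, Finset.card_image_of_injOn]
  · rfl
  · exact arcBlock_injOn.mono fun u hu => hq u (Finset.mem_filter.1 hu).1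

theorem jacobiWeight_image_arcBlock (l a : ℕ → ℝ) {q : Finset (ℕ × ℕ)}
    (hq : ∀ u ∈ q, u.1 ≤ u.2) : jacobiWeight l a (q.image arcBlock) = arcWeight l a q := by
  unfold jacobiWeight arcWeight
  rw [Finset.prod_filter, Finset.prod_filter, ← Finset.prod_mul_distrib,
    Finset.prod_image (arcBlock_injOn.mono hq)]
  refine Finset.prod_congr rfl fun v hv => ?_
  rw [blockDepth_image_arcBlock hq (hq v hv), card_arcBlock]
  split_ifs <;> simp_all

theorem nonCrossing_image_arcBlock_iff {q : Finset (ℕ × ℕ)} (hq : ∀ u ∈ q, u.1 ≤ u.2) :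
    NonCrossing (q.image arcBlock) ↔
      ∀ u ∈ q, ∀ v ∈ q, ¬ (u.1 < v.1 ∧ v.1 < u.2 ∧ u.2 < v.2) := by
  simp only [NonCrossing, Finset.forall_mem_image]
  refine forall₂_congr fun u hu => forall₂_congr fun v hv => ?_
  have hu' := hq u hu
  have hv' := hq v hv
  simp only [mem_arcBlock]
  constructor
  · rintro h h1
    refine h (fun hc => ?_) ⟨u.1, Or.inl rfl, v.1, Or.inl rfl, u.2, Or.inr rfl, v.2, Or.inr rfl, h1⟩
    have := arcBlock_injOn hu' hv' hc
    subst this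
    omega
  · rintro h - ⟨i, hi, j, hj, i', hi', j', hj', h1⟩
    omega

theorem isPartition12_image_arcBlock_iff {n : ℕ} {q : Finset (ℕ × ℕ)}
    (hq : ∀ u ∈ q, u.1 ≤ u.2) :
    IsPartition12 n (q.image arcBlock) ↔
      (∀ i, (∃ v ∈ q, i = v.1 ∨ i = v.2) ↔ 1 ≤ i ∧ i ≤ n) ∧
      ∀ u ∈ q, ∀ v ∈ q, u ≠ v → u.1 ≠ v.1 ∧ u.1 ≠ v.2 ∧ u.2 ≠ v.1 ∧ u.2 ≠ v.2 := by
  simp only [IsPartition12, Finset.forall_mem_image, Finset.exists_mem_image, mem_arcBlock,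
    Finset.mem_Icc, card_arcBlock]
  have hcard : ∀ v ∈ q, (if v.1 = v.2 then 1 else 2) = 1 ∨ (if v.1 = v.2 then 1 else 2) = 2 := by
    intro v _
    split_ifs <;> simp
  rw [and_iff_right hcard]
  refine and_congr_right fun _ => forall₂_congr fun u hu => forall₂_congr fun v hv => ?_
  rw [ne_eq, arcBlock_injOn.eq_iff (hq u hu) (hq v hv), Finset.disjoint_left]
  refine imp_congr_right fun _ => ?_
  simp only [mem_arcBlock]
  constructor
  · intro h
    have h1 := @h u.1 (Or.inl rfl)
    have h2 := @h u.2 (Or.inr rfl)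
    omega
  · intro h i hi
    omega

theorem mem_NC12 {k n : ℕ} {π : Finset (Finset ℕ)} :
    π ∈ NC12 k n ↔ IsPartition12 n π ∧ NonCrossing π ∧
      ∀ V ∈ π, V.card = 2 → blockDepth π V ≤ k - 1 := by
  simp only [NC12, Finset.mem_filter, Finset.mem_powerset, and_iff_right_iff_imp]
  rintro ⟨hπ, -⟩ V hV
  exact Finset.mem_powerset.2 fun i hi => (hπ.2.1 i).1 ⟨V, hV, hi⟩

theorem isArcSystem_iff_image_mem_NC12 {k n : ℕ} {q : Finset (ℕ × ℕ)}
    (hq : ∀ u ∈ q, u.1 ≤ u.2) :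
    IsArcSystem k 0 n 0 q ↔ q.image arcBlock ∈ NC12 k n := by
  have hdepth : (∀ V ∈ q.image arcBlock, V.card = 2 → blockDepth (q.image arcBlock) V ≤ k - 1) ↔
      ∀ v ∈ q, v.1 < v.2 → arcDepth q v ≤ k - 1 := by
    rw [Finset.forall_mem_image]
    refine forall₂_congr fun v hv => ?_
    have := hq v hv
    rw [blockDepth_image_arcBlock hq this, card_arcBlock]
    refine imp_congr_left ?_
    split_ifs <;> omega
  rw [mem_NC12, hdepth, nonCrossing_image_arcBlock_iff hq, isPartition12_image_arcBlock_iff hq]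
  constructor
  · intro H
    have h0 : ∀ v ∈ q, v.1 ≠ 0 := fun v hv =>
      Finset.filter_eq_empty_iff.1 (Finset.card_eq_zero.1 H.card_open) hv
    refine ⟨⟨fun i => ⟨?_, ?_⟩, ?_⟩, H.noncrossing, H.depth_le⟩
    · rintro ⟨v, hv, h⟩
      have h1 := h0 v hv
      have h2 := H.bounds v hv
      omega
    · rintro ⟨h1, h2⟩
      obtain ⟨v, hv, h⟩ := H.cover i h1 h2
      exact ⟨v, hv, h.imp Eq.symm Eq.symm⟩
    · intro u hu v hv huv
      have h1 := H.disj u hu v hv huv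
      have h2 := H.disj v hv u hu huv.symm
      have h3 := h0 u hu
      omega
  · rintro ⟨⟨hcover, hdisj⟩, hnc, hd⟩
    have hb : ∀ v ∈ q, 1 ≤ v.1 ∧ v.2 ≤ n := fun v hv =>
      ⟨((hcover v.1).1 ⟨v, hv, Or.inl rfl⟩).1, ((hcover v.2).1 ⟨v, hv, Or.inr rfl⟩).2⟩
    refine ⟨?_, ?_, ?_, hnc, hd, ?_⟩
    · intro v hv
      have h1 := hb v hv
      have h2 := hq v hv
      omega
    · intro i h1 h2
      obtain ⟨v, hv, h⟩ := (hcover i).2 ⟨h1, h2⟩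
      exact ⟨v, hv, h.imp Eq.symm Eq.symm⟩
    · intro u hu v hv huv
      have h1 := hdisj u hu v hv huv
      omega
    · rw [Finset.card_eq_zero, Finset.filter_eq_empty_iff]
      intro v hv
      have h1 := hb v hv
      omega

theorem exists_image_arcBlock_eq {π : Finset (Finset ℕ)}
    (hπ : ∀ V ∈ π, V.card = 1 ∨ V.card = 2) :
    ∃ q : Finset (ℕ × ℕ), (∀ u ∈ q, u.1 ≤ u.2) ∧ q.image arcBlock = π := by
  have hblock : ∀ V ∈ π, ∃ v : ℕ × ℕ, v.1 ≤ v.2 ∧ arcBlock v = V := by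
    intro V hV
    rcases hπ V hV with h | h
    · obtain ⟨i, rfl⟩ := Finset.card_eq_one.1 h
      exact ⟨(i, i), le_rfl, by simp [arcBlock]⟩
    · obtain ⟨i, j, -, rfl⟩ := Finset.card_eq_two.1 h
      rcases le_total i j with hij | hij
      · exact ⟨(i, j), hij, rfl⟩
      · exact ⟨(j, i), hij, Finset.pair_comm _ _⟩
  choose! f hf using hblock
  refine ⟨π.image f, Finset.forall_mem_image.2 fun V hV => (hf V hV).1, ?_⟩
  rw [Finset.image_image]
  conv_rhs => rw [← Finset.image_id (s := π)]
  exact Finset.image_congr fun V hV => (hf V hV).2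

theorem arcSum_eq_sum_NC12 (l a : ℕ → ℝ) (k n : ℕ) :
    arcSum l a k 0 n 0 = ∑ π ∈ NC12 k n, jacobiWeight l a π := by
  have hle : ∀ q ∈ arcSystems k 0 n 0, ∀ u ∈ q, u.1 ≤ u.2 := fun q hq u hu =>
    ((mem_arcSystems.1 hq).bounds u hu).2.1
  refine Finset.sum_bij (fun q _ => q.image arcBlock) ?_ ?_ ?_ ?_
  · intro q hq
    exact (isArcSystem_iff_image_mem_NC12 (hle q hq)).1 (mem_arcSystems.1 hq)
  · intro q hq q' hq' h
    have h1 := congrArg (fun s : Finset (Finset ℕ) => (s : Set (Finset ℕ))) h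
    simp only [Finset.coe_image] at h1
    exact Finset.coe_injective
      ((arcBlock_injOn.image_eq_image_iff (hle q hq) (hle q' hq')).1 h1)
  · intro π hπ
    obtain ⟨q, hq, rfl⟩ := exists_image_arcBlock_eq (mem_NC12.1 hπ).1.1
    exact ⟨q, mem_arcSystems.2 ((isArcSystem_iff_image_mem_NC12 hq).2 hπ), rfl⟩
  · intro q hq
    exact (jacobiWeight_image_arcBlock l a (hle q hq)).symm

theorem stmt8 (k : ℕ) (hk : 1 ≤ k) (l a : ℕ → ℝ) (n : ℕ) :
    (Tmat k l a ^ n) ⟨0, hk⟩ ⟨0, hk⟩ = ∑ π ∈ NC12 k n, jacobiWeight l a π := by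
  rw [Tmat_pow_zero_apply l a hk n n 0 (by omega), arcSum_eq_sum_NC12]
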